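/- arXiv:2006.16435 — 2 statements merged into one kernel-verified Lean document; each statement's English description precedes it below -/
import Mathlib

section
/- Let (φ_i, ξ_i, η_i), i = 1,2,3, be an abelian almost 3-contact structure on a finite-dimensional real Lie algebra 𝔤 such that ψ = 0 and 𝒵 = 0, where 𝒵 := φ_1([ξ_2, ξ_3]), and let δ ∈ ℝ be the number with η_1([ξ_2, ξ_3]) = 2δ. Then [ξ_i, X] = 0 for all X ∈ 𝔥 and i = 1,2,3, and [ξ_i, ξ_j] = 2δ·ξ_k for every even permutation (i,j,k) of (1,2,3). Moreover: (1) if δ = 0 then ξ_1, ξ_2, ξ_3 lie in the center of 𝔤; (2) if δ ≠ 0 then [X, Y] ∈ 𝔥 for all X, Y ∈ 𝔥, so both 𝔳 and 𝔥 are ideals of 𝔤 and 𝔤 is their direct sum as Lie algebras. -/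
/-- `(i,j,k)` is an even permutation of `(1,2,3)` (indexed here as `(0,1,2)`). -/
def evenPerm (i j k : Fin 3) : Prop :=
  (i, j, k) = ((0 : Fin 3), (1 : Fin 3), (2 : Fin 3)) ∨
  (i, j, k) = ((1 : Fin 3), (2 : Fin 3), (0 : Fin 3)) ∨
  (i, j, k) = ((2 : Fin 3), (0 : Fin 3), (1 : Fin 3))

/-- An abelian almost 3-contact structure on a real Lie algebra `L`: three almost
contact structures `(φ i, ξ i, η i)` satisfying the quaternionic-like compatibility
relations for every even permutation `(i,j,k)` of `(1,2,3)`, each of which is abelian. -/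
structure AbelianAC3 (L : Type*) [LieRing L] [LieAlgebra ℝ L] where
  φ : Fin 3 → (L →ₗ[ℝ] L)
  ξ : Fin 3 → L
  η : Fin 3 → (L →ₗ[ℝ] ℝ)
  acs : ∀ i, ∀ x : L, φ i (φ i x) = -x + η i x • ξ i
  unit : ∀ i, η i (ξ i) = 1
  comp_phi : ∀ i j k, evenPerm i j k → ∀ x : L, φ k x = φ i (φ j x) - η j x • ξ i
  comp_phi' : ∀ i j k, evenPerm i j k → ∀ x : L, φ k x = -φ j (φ i x) + η i x • ξ j
  comp_xi : ∀ i j k, evenPerm i j k → φ i (ξ j) = ξ k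
  comp_xi' : ∀ i j k, evenPerm i j k → φ j (ξ i) = -ξ k
  comp_eta : ∀ i j k, evenPerm i j k → ∀ x : L, η i (φ j x) = η k x
  comp_eta' : ∀ i j k, evenPerm i j k → ∀ x : L, η j (φ i x) = -η k x
  abelian_ad : ∀ i, ∀ x : L, ⁅ξ i, φ i x⁆ = φ i ⁅ξ i, x⁆
  abelian_br : ∀ i, ∀ X Y : L, η i X = 0 → η i Y = 0 → ⁅φ i X, φ i Y⁆ = ⁅X, Y⁆

namespace AbelianAC3

variable {L : Type*} [LieRing L] [LieAlgebra ℝ L]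

/-- Membership in the horizontal subspace `𝔥 = ⋂ ker (η i)`. -/
def inH (S : AbelianAC3 L) (x : L) : Prop := ∀ i, S.η i x = 0

/-- The horizontal subspace `𝔥` as a submodule. -/
def H (S : AbelianAC3 L) : Submodule ℝ L :=
  LinearMap.ker (S.η 0) ⊓ LinearMap.ker (S.η 1) ⊓ LinearMap.ker (S.η 2)

/-- The vertical subspace `𝔳 = span{ξ₁, ξ₂, ξ₃}`. -/
def V (S : AbelianAC3 L) : Submodule ℝ L :=
  Submodule.span ℝ {S.ξ 0, S.ξ 1, S.ξ 2}

/-- The endomorphism `ψ(X) = [ξ₁, φ₁ X]` (as a linear map on all of `L`). -/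
def psi (S : AbelianAC3 L) : L →ₗ[ℝ] L :=
  (LieAlgebra.ad ℝ L (S.ξ 0)) ∘ₗ (S.φ 0)

/-- The distinguished horizontal vector `𝒵 = φ₁([ξ₂, ξ₃])`. -/
def Z (S : AbelianAC3 L) : L := S.φ 0 ⁅S.ξ 1, S.ξ 2⁆

end AbelianAC3

namespace AbelianAC3

variable {L : Type*} [LieRing L] [LieAlgebra ℝ L]

theorem evenPerm_012 : evenPerm 0 1 2 := Or.inl rfl

theorem evenPerm_120 : evenPerm 1 2 0 := Or.inr (Or.inl rfl)

theorem evenPerm_201 : evenPerm 2 0 1 := Or.inr (Or.inr rfl)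

theorem exists_evenPerm (i : Fin 3) : ∃ j k, evenPerm i j k := by
  fin_cases i
  exacts [⟨1, 2, evenPerm_012⟩, ⟨2, 0, evenPerm_120⟩, ⟨0, 1, evenPerm_201⟩]

theorem xi_ne_zero (S : AbelianAC3 L) (i : Fin 3) : S.ξ i ≠ 0 := fun h => by
  simpa [h] using S.unit i

theorem phi_xi_self (S : AbelianAC3 L) (i : Fin 3) : S.φ i (S.ξ i) = 0 := by
  have h0 : S.φ i (S.φ i (S.ξ i)) = 0 := by simp [S.acs, S.unit]
  have h1 := S.acs i (S.φ i (S.ξ i))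
  rw [h0, map_zero] at h1
  have h2 : S.φ i (S.ξ i) = S.η i (S.φ i (S.ξ i)) • S.ξ i := by
    rwa [eq_comm, neg_add_eq_zero] at h1
  have h3 : S.η i (S.φ i (S.ξ i)) • S.φ i (S.ξ i) = 0 := by
    rw [← map_smul, ← h2, h0]
  rcases smul_eq_zero.mp h3 with h | h
  · rw [h2, h, zero_smul]
  · exact h

theorem eta_phi_self (S : AbelianAC3 L) (i : Fin 3) (x : L) : S.η i (S.φ i x) = 0 := by
  have h := S.acs i (S.φ i x)
  rw [S.acs i x, map_add, map_neg, map_smul, phi_xi_self, smul_zero, add_zero,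
    left_eq_add] at h
  exact (smul_eq_zero.mp h).resolve_right (S.xi_ne_zero i)

theorem eta_xi_of_evenPerm (S : AbelianAC3 L) {i j k : Fin 3} (h : evenPerm i j k) :
    S.η k (S.ξ j) = 0 ∧ S.η k (S.ξ i) = 0 := by
  constructor
  · rw [← S.comp_eta i j k h, phi_xi_self, map_zero]
  · have := S.comp_eta' i j k h (S.ξ i)
    rw [phi_xi_self, map_zero] at this
    linarith

theorem eta_xi (S : AbelianAC3 L) (i j : Fin 3) :
    S.η i (S.ξ j) = if i = j then 1 else 0 := by
  have h0 := S.eta_xi_of_evenPerm evenPerm_120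
  have h1 := S.eta_xi_of_evenPerm evenPerm_201
  have h2 := S.eta_xi_of_evenPerm evenPerm_012
  fin_cases i <;> fin_cases j <;> simp [S.unit, h0, h1, h2]

theorem inH_phi (S : AbelianAC3 L) (i : Fin 3) {X : L} (hX : S.inH X) :
    S.inH (S.φ i X) := by
  have e0 := S.comp_eta _ _ _ evenPerm_012 X
  have e1 := S.comp_eta _ _ _ evenPerm_120 X
  have e2 := S.comp_eta _ _ _ evenPerm_201 X
  have f0 := S.comp_eta' _ _ _ evenPerm_012 X
  have f1 := S.comp_eta' _ _ _ evenPerm_120 X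
  have f2 := S.comp_eta' _ _ _ evenPerm_201 X
  rw [hX] at e0 e1 e2 f0 f1 f2
  intro j
  fin_cases i <;> fin_cases j <;> simp_all [eta_phi_self]

theorem phi_phi_of_inH (S : AbelianAC3 L) (i : Fin 3) {X : L} (hX : S.inH X) :
    S.φ i (S.φ i X) = -X := by
  rw [S.acs, hX, zero_smul, add_zero]

/-- The relation `[ξ_k, φ_i X] = [ξ_j, X]` for horizontal `X`. -/
theorem lie_xi_phi (S : AbelianAC3 L) {i j k : Fin 3} (h : evenPerm i j k) {X : L}
    (hX : S.inH X) : ⁅S.ξ k, S.φ i X⁆ = ⁅S.ξ j, X⁆ := by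
  have hij : i ≠ j := by rcases h with h | h | h <;> simp_all
  rw [← S.comp_xi i j k h]
  exact S.abelian_br i _ _ (by simp [eta_xi, hij]) (hX i)

theorem lie_xi_eq_zero (S : AbelianAC3 L) (hψ : ∀ X : L, S.inH X → S.psi X = 0)
    (i : Fin 3) {X : L} (hX : S.inH X) : ⁅S.ξ i, X⁆ = 0 := by
  have h0 : ∀ {Y : L}, S.inH Y → ⁅S.ξ 0, Y⁆ = 0 := fun {Y} hY => by
    have h := hψ _ (S.inH_phi 0 hY)
    rwa [psi, LinearMap.comp_apply, S.phi_phi_of_inH 0 hY, map_neg, neg_eq_zero] at h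
  have h2 : ∀ {Y : L}, S.inH Y → ⁅S.ξ 2, Y⁆ = 0 := fun {Y} hY => by
    rw [← S.lie_xi_phi evenPerm_120 hY, h0 (S.inH_phi 1 hY)]
  fin_cases i
  · exact h0 hX
  · exact (S.lie_xi_phi evenPerm_012 hX).symm.trans (h2 (S.inH_phi 0 hX))
  · exact h2 hX

theorem lie_xi_xi (S : AbelianAC3 L) (hZ : S.Z = 0) {c : ℝ}
    (hc : S.η 0 ⁅S.ξ 1, S.ξ 2⁆ = c) {i j k : Fin 3} (h : evenPerm i j k) :
    ⁅S.ξ i, S.ξ j⁆ = c • S.ξ k := by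
  have h12 : ⁅S.ξ 1, S.ξ 2⁆ = c • S.ξ 0 := by
    have h := S.acs 0 ⁅S.ξ 1, S.ξ 2⁆
    rw [show S.φ 0 ⁅S.ξ 1, S.ξ 2⁆ = 0 from hZ, map_zero, hc] at h
    rwa [eq_comm, neg_add_eq_zero] at h
  have h01 : ⁅S.ξ 0, S.ξ 1⁆ = c • S.ξ 2 := by
    have h := S.abelian_ad 1 (S.ξ 2)
    rw [h12, S.comp_xi _ _ _ evenPerm_120, map_smul, S.comp_xi' _ _ _ evenPerm_012] at h
    rw [← lie_skew, h, smul_neg, neg_neg]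
  have h20 : ⁅S.ξ 2, S.ξ 0⁆ = c • S.ξ 1 := by
    have h := S.abelian_ad 2 (S.ξ 1)
    rw [← lie_skew (S.ξ 2) (S.ξ 1), h12, S.comp_xi' _ _ _ evenPerm_120, map_neg, map_smul,
      S.comp_xi _ _ _ evenPerm_201, lie_neg] at h
    exact neg_injective h
  rcases h with h | h | h <;> obtain ⟨rfl, rfl, rfl⟩ := by simpa using h
  exacts [h01, h12, h20]

/-- The horizontal component of a vector. -/
def horizontalPart (S : AbelianAC3 L) (x : L) : L := x - ∑ i, S.η i x • S.ξ i

theorem inH_horizontalPart (S : AbelianAC3 L) (x : L) : S.inH (S.horizontalPart x) := by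
  intro j
  simp [horizontalPart, eta_xi]

theorem sum_add_horizontalPart (S : AbelianAC3 L) (x : L) :
    ∑ i, S.η i x • S.ξ i + S.horizontalPart x = x := add_sub_cancel _ _

theorem mem_H (S : AbelianAC3 L) {x : L} : x ∈ S.H ↔ S.inH x := by
  simp [H, inH, Fin.forall_fin_succ, and_assoc]

theorem xi_mem_V (S : AbelianAC3 L) (i : Fin 3) : S.ξ i ∈ S.V := by
  apply Submodule.subset_span
  fin_cases i <;> simp

theorem sum_smul_xi_mem_V (S : AbelianAC3 L) (a : Fin 3 → ℝ) : ∑ i, a i • S.ξ i ∈ S.V :=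
  Submodule.sum_mem _ fun i _ => Submodule.smul_mem _ _ (S.xi_mem_V i)

theorem disjoint_V_H (S : AbelianAC3 L) : S.V ⊓ S.H = ⊥ := by
  rw [eq_bot_iff]
  rintro x ⟨hV, hH⟩
  obtain ⟨a, b, c, rfl⟩ := Submodule.mem_span_triple.mp hV
  have h := S.mem_H.mp hH
  have h0 := h 0
  have h1 := h 1
  have h2 := h 2
  simp [eta_xi] at h0 h1 h2
  simp [h0, h1, h2]

theorem V_sup_H (S : AbelianAC3 L) : S.V ⊔ S.H = ⊤ := by
  rw [eq_top_iff]
  intro x _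
  rw [← S.sum_add_horizontalPart x]
  exact Submodule.add_mem_sup (S.sum_smul_xi_mem_V _) (S.mem_H.mpr (S.inH_horizontalPart x))

theorem lie_xi_eq_sum (S : AbelianAC3 L) (hξ : ∀ i, ∀ X : L, S.inH X → ⁅S.ξ i, X⁆ = 0)
    (i : Fin 3) (x : L) : ⁅S.ξ i, x⁆ = ∑ j, S.η j x • ⁅S.ξ i, S.ξ j⁆ := by
  conv_lhs => rw [← S.sum_add_horizontalPart x]
  rw [lie_add, hξ i _ (S.inH_horizontalPart x), add_zero, lie_sum]
  simp only [lie_smul]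

theorem lie_xi_eq (S : AbelianAC3 L) (hξ : ∀ i, ∀ X : L, S.inH X → ⁅S.ξ i, X⁆ = 0)
    {c : ℝ} (hc : ∀ i j k, evenPerm i j k → ⁅S.ξ i, S.ξ j⁆ = c • S.ξ k)
    {i j k : Fin 3} (h : evenPerm i j k) (x : L) :
    ⁅S.ξ i, x⁆ = c • (S.η j x • S.ξ k - S.η k x • S.ξ j) := by
  have h01 := hc _ _ _ evenPerm_012
  have h12 := hc _ _ _ evenPerm_120
  have h20 := hc _ _ _ evenPerm_201
  have h10 : ⁅S.ξ 1, S.ξ 0⁆ = -(c • S.ξ 2) := by rw [← lie_skew, h01]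
  have h21 : ⁅S.ξ 2, S.ξ 1⁆ = -(c • S.ξ 0) := by rw [← lie_skew, h12]
  have h02 : ⁅S.ξ 0, S.ξ 2⁆ = -(c • S.ξ 1) := by rw [← lie_skew, h20]
  rw [S.lie_xi_eq_sum hξ, Fin.sum_univ_three]
  rcases h with h | h | h <;> obtain ⟨rfl, rfl, rfl⟩ := by simpa using h
  all_goals
    simp only [lie_self, h01, h12, h20, h10, h21, h02]
    module

theorem inH_lie (S : AbelianAC3 L) (hξ : ∀ i, ∀ X : L, S.inH X → ⁅S.ξ i, X⁆ = 0)
    {c : ℝ} (hc : ∀ i j k, evenPerm i j k → ⁅S.ξ i, S.ξ j⁆ = c • S.ξ k) (hc0 : c ≠ 0)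
    {X Y : L} (hX : S.inH X) (hY : S.inH Y) : S.inH ⁅X, Y⁆ := by
  have key : ∀ {i j k}, evenPerm i j k → S.η j ⁅X, Y⁆ = 0 := fun {i j k} h => by
    have hkj : k ≠ j := by rcases h with h | h | h <;> simp_all
    have h0 : ⁅S.ξ i, ⁅X, Y⁆⁆ = 0 := by
      rw [leibniz_lie, hξ i X hX, hξ i Y hY, zero_lie, lie_zero, add_zero]
    rw [S.lie_xi_eq hξ hc h] at h0
    have h1 := congrArg (S.η k) ((smul_eq_zero.mp h0).resolve_left hc0)
    simpa [eta_xi, hkj] using h1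
  intro i
  fin_cases i
  exacts [key evenPerm_201, key evenPerm_012, key evenPerm_120]

end AbelianAC3


/-- if `ψ = 0` and `𝒵 = 0`, then `[ξ_i, X] = 0` for `X ∈ 𝔥` and
`[ξ_i, ξ_j] = 2δ·ξ_k`.  If `δ = 0` the Reeb vectors are central; if `δ ≠ 0` then `𝔥`
is closed under the bracket, both `𝔳` and `𝔥` are ideals and `𝔤 = 𝔳 ⊕ 𝔥`. -/
theorem AbelianAC3.psi_zero_Z_zero
    {L : Type*} [LieRing L] [LieAlgebra ℝ L] [FiniteDimensional ℝ L]
    (S : AbelianAC3 L)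
    (hψ : ∀ X : L, S.inH X → S.psi X = 0)
    (hZ : S.Z = 0)
    (δ : ℝ) (hδ : S.η 0 ⁅S.ξ 1, S.ξ 2⁆ = 2 * δ) :
    (∀ i, ∀ X : L, S.inH X → ⁅S.ξ i, X⁆ = 0) ∧
    (∀ i j k, evenPerm i j k → ⁅S.ξ i, S.ξ j⁆ = (2 * δ) • S.ξ k) ∧
    (δ = 0 → ∀ i, ∀ x : L, ⁅S.ξ i, x⁆ = 0) ∧
    (δ ≠ 0 →
      (∀ X Y : L, S.inH X → S.inH Y → S.inH ⁅X, Y⁆) ∧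
      (∀ x ∈ S.V, ∀ y : L, ⁅y, x⁆ ∈ S.V) ∧
      (∀ x ∈ S.H, ∀ y : L, ⁅y, x⁆ ∈ S.H) ∧
      S.V ⊓ S.H = ⊥ ∧ S.V ⊔ S.H = ⊤) := by
  have hξ : ∀ i, ∀ X : L, S.inH X → ⁅S.ξ i, X⁆ = 0 := fun i X hX => S.lie_xi_eq_zero hψ i hX
  have hc : ∀ i j k, evenPerm i j k → ⁅S.ξ i, S.ξ j⁆ = (2 * δ) • S.ξ k :=
    fun i j k h => S.lie_xi_xi hZ hδ h
  refine ⟨hξ, hc, ?_, fun hne => ?_⟩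
  · rintro rfl i x
    obtain ⟨j, k, h⟩ := exists_evenPerm i
    rw [S.lie_xi_eq hξ hc h, mul_zero, zero_smul]
  · have hHH : ∀ X Y : L, S.inH X → S.inH Y → S.inH ⁅X, Y⁆ := fun X Y hX hY =>
      S.inH_lie hξ hc (mul_ne_zero two_ne_zero hne) hX hY
    refine ⟨hHH, fun x hx y => ?_, fun x hx y => ?_, S.disjoint_V_H, S.V_sup_H⟩
    · have hi : ∀ i, ⁅y, S.ξ i⁆ ∈ S.V := fun i => by
        obtain ⟨j, k, h⟩ := exists_evenPerm i
        rw [← lie_skew, S.lie_xi_eq hξ hc h]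
        exact S.V.neg_mem (S.V.smul_mem _ (S.V.sub_mem (S.V.smul_mem _ (S.xi_mem_V k))
          (S.V.smul_mem _ (S.xi_mem_V j))))
      obtain ⟨a, b, c, rfl⟩ := Submodule.mem_span_triple.mp hx
      simp only [lie_add, lie_smul]
      exact S.V.add_mem (S.V.add_mem (S.V.smul_mem _ (hi 0)) (S.V.smul_mem _ (hi 1)))
        (S.V.smul_mem _ (hi 2))
    · rw [S.mem_H] at hx ⊢
      rw [← S.sum_add_horizontalPart y, add_lie, sum_lie]
      simpa [hξ _ x hx] using hHH _ _ (S.inH_horizontalPart y) hx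
end

section
/- Let (φ_i, ξ_i, η_i), i = 1,2,3, be an abelian almost 3-contact structure on a finite-dimensional real Lie algebra 𝔤 such that ψ = 0 and 𝒵 ≠ 0, where 𝒵 := φ_1([ξ_2, ξ_3]); let δ ∈ ℝ be the number with η_1([ξ_2, ξ_3]) = 2δ, and set 𝒵_i := φ_i(𝒵) for i = 1,2,3. Then: (a) [ξ_i, X] = 0 for all X ∈ 𝔥 and [ξ_i, ξ_j] = 2δ·ξ_k − 𝒵_k for every even permutation (i,j,k) of (1,2,3); (b) 𝔥 is an ideal of 𝔤, i.e. [X, Y] ∈ 𝔥 for all X, Y ∈ 𝔥; (c) [𝒵, X] = 0 and [𝒵_i, X] = 0 for all X ∈ 𝔥 and i = 1,2,3; (d) if δ ≠ 0, then the elements u_i := 2δ·ξ_i − 𝒵_i satisfy [u_i, u_j] = 4δ²·u_k for every even permutation (i,j,k) of (1,2,3), so span{u_1, u_2, u_3} is an ideal of 𝔤 isomorphic to 𝔰𝔬(3). -/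
theorem evenPerm.rotate {i j k : Fin 3} (h : evenPerm i j k) : evenPerm j k i := by
  rcases h with h | h | h <;> obtain ⟨rfl, rfl, rfl⟩ := by simpa using h
  · exact Or.inr (Or.inl rfl)
  · exact Or.inr (Or.inr rfl)
  · exact Or.inl rfl

theorem exists_evenPerm (i : Fin 3) : ∃ j k, evenPerm i j k := by
  fin_cases i
  · exact ⟨1, 2, Or.inl rfl⟩
  · exact ⟨2, 0, Or.inr (Or.inl rfl)⟩
  · exact ⟨0, 1, Or.inr (Or.inr rfl)⟩

namespace AbelianAC3

variable {L : Type*} [LieRing L] [LieAlgebra ℝ L] (S : AbelianAC3 L) {i j k : Fin 3}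

theorem ξ_ne_zero (i : Fin 3) : S.ξ i ≠ 0 := fun h => by
  simpa [h] using S.unit i

theorem φ_ξ_self (i : Fin 3) : S.φ i (S.ξ i) = 0 := by
  have h2 : S.φ i (S.φ i (S.ξ i)) = 0 := by simp [S.acs, S.unit]
  have h3 := S.acs i (S.φ i (S.ξ i))
  rw [h2, map_zero] at h3
  have h4 : S.φ i (S.ξ i) = S.η i (S.φ i (S.ξ i)) • S.ξ i := by
    rw [eq_comm, ← sub_eq_zero, h3]; abel
  generalize S.η i (S.φ i (S.ξ i)) = c at h4
  rw [h4, map_smul, h4, smul_smul] at h2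
  have hc : c = 0 := by simpa [S.ξ_ne_zero i] using h2
  rw [h4, hc, zero_smul]

theorem η_φ_self (i : Fin 3) (x : L) : S.η i (S.φ i x) = 0 := by
  have h := S.acs i (S.φ i x)
  rw [S.acs i x, map_add, map_neg, map_smul, S.φ_ξ_self, smul_zero, add_zero] at h
  simpa [S.ξ_ne_zero i] using h

theorem η_lie_ξ_self (i : Fin 3) (x : L) : S.η i ⁅S.ξ i, x⁆ = 0 := by
  have h := S.acs i ⁅S.ξ i, x⁆
  rw [← S.abelian_ad, ← S.abelian_ad, S.acs] at h
  simpa [S.ξ_ne_zero i] using h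

theorem η_ξ_prev (h : evenPerm i j k) : S.η k (S.ξ j) = 0 := by
  rw [← S.comp_eta i j k h, S.φ_ξ_self, map_zero]

theorem η_ξ_next (h : evenPerm i j k) : S.η k (S.ξ i) = 0 := by
  rw [← neg_eq_zero, ← S.comp_eta' i j k h, S.φ_ξ_self, map_zero]

variable {S} in
theorem inH_of_evenPerm (h : evenPerm i j k) {x : L} (hi : S.η i x = 0) (hj : S.η j x = 0)
    (hk : S.η k x = 0) : S.inH x := by
  intro l
  rcases h with h | h | h <;> obtain ⟨rfl, rfl, rfl⟩ := by simpa using h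
  all_goals fin_cases l <;> assumption

variable {S} in
theorem inH.φ {x : L} (hx : S.inH x) (i : Fin 3) : S.inH (S.φ i x) := by
  obtain ⟨j, k, h⟩ := exists_evenPerm i
  refine inH_of_evenPerm h (S.η_φ_self i x) ?_ ?_
  · rw [S.comp_eta' i j k h, hx, neg_zero]
  · rw [S.comp_eta k i j h.rotate.rotate, hx]

variable {S} in
theorem inH.φ_φ_self {x : L} (hx : S.inH x) (i : Fin 3) : S.φ i (S.φ i x) = -x := by
  rw [S.acs, hx, zero_smul, add_zero]

variable {S} in
theorem inH.φ_φ {x : L} (hx : S.inH x) (h : evenPerm i j k) : S.φ i (S.φ j x) = S.φ k x := by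
  rw [S.comp_phi i j k h, hx, zero_smul, sub_zero]

variable {S} in
theorem inH.φ_φ_rev {x : L} (hx : S.inH x) (h : evenPerm i j k) :
    S.φ j (S.φ i x) = -S.φ k x := by
  rw [S.comp_phi' i j k h, hx, zero_smul, add_zero, neg_neg]

variable {S} in
theorem mem_H_iff {x : L} : x ∈ S.H ↔ S.inH x := by
  simp [H, inH, Fin.forall_fin_succ, and_assoc]

theorem inH_horizontal_part (h : evenPerm i j k) (x : L) :
    S.inH (x - S.η i x • S.ξ i - S.η j x • S.ξ j - S.η k x • S.ξ k) := by
  refine inH_of_evenPerm h ?_ ?_ ?_ <;>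
  simp [S.unit, S.η_ξ_prev h, S.η_ξ_prev h.rotate, S.η_ξ_prev h.rotate.rotate,
    S.η_ξ_next h, S.η_ξ_next h.rotate, S.η_ξ_next h.rotate.rotate]

theorem inH_Z : S.inH S.Z := by
  have h : evenPerm 0 1 2 := Or.inl rfl
  refine inH_of_evenPerm h (S.η_φ_self 0 _) ?_ ?_
  · rw [Z, S.comp_eta' 0 1 2 h, ← lie_skew, map_neg, S.η_lie_ξ_self, neg_zero, neg_zero]
  · rw [Z, S.comp_eta 2 0 1 h.rotate.rotate, S.η_lie_ξ_self]

/-- If `ψ` vanishes on `𝔥`, then every `ad ξ_i` vanishes on `𝔥`. -/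
theorem lie_ξ_of_inH (hψ : ∀ X : L, S.inH X → S.psi X = 0) (i : Fin 3) {X : L}
    (hX : S.inH X) : ⁅S.ξ i, X⁆ = 0 := by
  have h : evenPerm 0 1 2 := Or.inl rfl
  have h0 {Y : L} (hY : S.inH Y) : ⁅S.ξ 0, Y⁆ = 0 := by
    have := hψ _ (hY.φ 0)
    simpa [psi, hY.φ_φ_self, -lie_skew, lie_neg] using this
  have h1 : ⁅S.ξ 1, X⁆ = 0 := by
    have := S.abelian_br 2 (S.ξ 0) (S.φ 2 X) (S.η_ξ_next h) (hX.φ 2 2)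
    simpa [S.comp_xi 2 0 1 h.rotate.rotate, hX.φ_φ_self, h0 (hX.φ 2), -lie_skew] using this
  have h2 : ⁅S.ξ 2, X⁆ = 0 := by
    have := S.abelian_br 1 (S.ξ 0) (S.φ 1 X) (S.η_ξ_prev h.rotate.rotate) (hX.φ 1 1)
    simpa [S.comp_xi' 0 1 2 h, hX.φ_φ_self, h0 (hX.φ 1), -lie_skew] using this
  fin_cases i
  exacts [h0 hX, h1, h2]

theorem φ_lie_ξ (h : evenPerm i j k) : S.φ i ⁅S.ξ i, S.ξ j⁆ = ⁅S.ξ i, S.ξ k⁆ := by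
  rw [← S.abelian_ad, S.comp_xi i j k h]

theorem lie_ξ_ξ {δ : ℝ} (hδ : S.η 0 ⁅S.ξ 1, S.ξ 2⁆ = 2 * δ) (h : evenPerm i j k) :
    ⁅S.ξ i, S.ξ j⁆ = (2 * δ) • S.ξ k - S.φ k S.Z := by
  have e : evenPerm 0 1 2 := Or.inl rfl
  have h12 : ⁅S.ξ 1, S.ξ 2⁆ = (2 * δ) • S.ξ 0 - S.φ 0 S.Z := by
    rw [Z, S.acs, hδ]; abel
  rcases h with h | h | h <;> obtain ⟨rfl, rfl, rfl⟩ := by simpa using h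
  · rw [← lie_skew, ← S.φ_lie_ξ e.rotate, h12, map_sub, map_smul, S.comp_xi' 0 1 2 e,
      S.inH_Z.φ_φ_rev e]
    module
  · exact h12
  · have := S.abelian_ad 2 (S.ξ 1)
    rw [S.comp_xi' 1 2 0 e.rotate, ← lie_skew (S.ξ 2) (S.ξ 1), h12, map_neg, map_sub, map_smul,
      S.comp_xi 2 0 1 e.rotate.rotate, S.inH_Z.φ_φ e.rotate.rotate, lie_neg, neg_inj] at this
    exact this

theorem lie_ξ_ξ_ne_zero (hZ : S.Z ≠ 0) (h : evenPerm i j k) : ⁅S.ξ i, S.ξ j⁆ ≠ 0 := by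
  obtain ⟨δ, hδ⟩ : ∃ δ, S.η 0 ⁅S.ξ 1, S.ξ 2⁆ = 2 * δ := ⟨_, (mul_div_cancel₀ _ two_ne_zero).symm⟩
  intro h0
  have := congrArg (S.φ k) (S.lie_ξ_ξ hδ h)
  rw [h0, map_sub, map_smul, S.φ_ξ_self, S.inH_Z.φ_φ_self] at this
  exact hZ (by simpa using this.symm)

theorem η_eq_zero_of_lie_ξ (hψ : ∀ X : L, S.inH X → S.psi X = 0) (hZ : S.Z ≠ 0)
    (h : evenPerm i j k) {W : L} (hW : ⁅S.ξ i, W⁆ = 0) : S.η j W = 0 := by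
  have hh := S.lie_ξ_of_inH hψ i (S.inH_horizontal_part h W)
  simp only [lie_sub, lie_smul, lie_self, hW, smul_zero, ← S.φ_lie_ξ h] at hh
  have hh' := congrArg (S.φ i) hh
  have hw : S.φ i (S.φ i ⁅S.ξ i, S.ξ j⁆) = -⁅S.ξ i, S.ξ j⁆ := by
    rw [S.acs, S.η_lie_ξ_self, zero_smul, add_zero]
  simp only [map_sub, map_smul, map_zero, hw] at hh'
  have hne := S.lie_ξ_ξ_ne_zero hZ h
  generalize ⁅S.ξ i, S.ξ j⁆ = w at *
  generalize S.η j W = a at *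
  generalize S.η k W = b at *
  have hab : (a * a + b * b) • w = 0 := by
    linear_combination (norm := module) (-a) • hh + b • hh'
  have := (smul_eq_zero.mp hab).resolve_right hne
  nlinarith [mul_self_nonneg a, mul_self_nonneg b]

theorem inH_lie_s18 (hψ : ∀ X : L, S.inH X → S.psi X = 0) (hZ : S.Z ≠ 0) {X Y : L}
    (hX : S.inH X) (hY : S.inH Y) : S.inH ⁅X, Y⁆ := by
  have hW (i : Fin 3) : ⁅S.ξ i, ⁅X, Y⁆⁆ = 0 := by
    rw [leibniz_lie, S.lie_ξ_of_inH hψ i hX, S.lie_ξ_of_inH hψ i hY, zero_lie, lie_zero, add_zero]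
  intro j
  obtain ⟨k, i, h⟩ := exists_evenPerm j
  exact S.η_eq_zero_of_lie_ξ hψ hZ h.rotate.rotate (hW i)

theorem lie_mem_H (hψ : ∀ X : L, S.inH X → S.psi X = 0) (hZ : S.Z ≠ 0) {x : L}
    (hx : S.inH x) (y : L) : S.inH ⁅y, x⁆ := by
  have := S.inH_lie_s18 hψ hZ (S.inH_horizontal_part (Or.inl rfl : evenPerm 0 1 2) y) hx
  simpa [sub_lie, smul_lie, S.lie_ξ_of_inH hψ _ hx] using this

theorem lie_φ_Z (hψ : ∀ X : L, S.inH X → S.psi X = 0) (k : Fin 3) {X : L} (hX : S.inH X) :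
    ⁅S.φ k S.Z, X⁆ = 0 := by
  obtain ⟨δ, hδ⟩ : ∃ δ, S.η 0 ⁅S.ξ 1, S.ξ 2⁆ = 2 * δ := ⟨_, (mul_div_cancel₀ _ two_ne_zero).symm⟩
  obtain ⟨i, j, h⟩ := exists_evenPerm k
  have := lie_lie (S.ξ i) (S.ξ j) X
  simpa [S.lie_ξ_ξ hδ h.rotate, S.lie_ξ_of_inH hψ _ hX, sub_lie, smul_lie, -lie_skew] using this

theorem lie_Z (hψ : ∀ X : L, S.inH X → S.psi X = 0) {X : L} (hX : S.inH X) : ⁅S.Z, X⁆ = 0 := by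
  rw [← S.abelian_br 0 _ _ (S.inH_Z 0) (hX 0), S.lie_φ_Z hψ 0 (hX.φ 0)]

theorem lie_smul_ξ_sub_φ_Z (hψ : ∀ X : L, S.inH X → S.psi X = 0) (c : ℝ) (i j : Fin 3) :
    ⁅c • S.ξ i - S.φ i S.Z, c • S.ξ j - S.φ j S.Z⁆ = (c * c) • ⁅S.ξ i, S.ξ j⁆ := by
  have hZ (l : Fin 3) := S.inH_Z.φ l
  have hξ : ⁅S.φ i S.Z, S.ξ j⁆ = 0 := by
    rw [← lie_skew, S.lie_ξ_of_inH hψ j (hZ i), neg_zero]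
  simp [hξ, S.lie_ξ_of_inH hψ i (hZ j), S.lie_φ_Z hψ i (hZ j), smul_smul]

end AbelianAC3


/-- structure of the Lie algebra when `ψ = 0` and `𝒵 ≠ 0`. -/
theorem AbelianAC3.psi_zero_Z_ne_zero
    {L : Type*} [LieRing L] [LieAlgebra ℝ L] [FiniteDimensional ℝ L]
    (S : AbelianAC3 L)
    (hψ : ∀ X : L, S.inH X → S.psi X = 0)
    (hZ : S.Z ≠ 0)
    (δ : ℝ) (hδ : S.η 0 ⁅S.ξ 1, S.ξ 2⁆ = 2 * δ) :
    -- (a)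
    ((∀ i, ∀ X : L, S.inH X → ⁅S.ξ i, X⁆ = 0) ∧
      (∀ i j k, evenPerm i j k →
        ⁅S.ξ i, S.ξ j⁆ = (2 * δ) • S.ξ k - S.φ k S.Z)) ∧
    -- (b) `𝔥` is an ideal
    ((∀ X Y : L, S.inH X → S.inH Y → S.inH ⁅X, Y⁆) ∧
      (∀ x ∈ S.H, ∀ y : L, ⁅y, x⁆ ∈ S.H)) ∧
    -- (c) `𝒵` and the `𝒵_i` are central in `𝔥`
    ((∀ X : L, S.inH X → ⁅S.Z, X⁆ = 0) ∧
      (∀ i, ∀ X : L, S.inH X → ⁅S.φ i S.Z, X⁆ = 0)) ∧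
    -- (d) if `δ ≠ 0`, the elements `u_i = 2δ·ξ_i − 𝒵_i` span a copy of `𝔰𝔬(3)`
    (δ ≠ 0 → ∀ i j k, evenPerm i j k →
      ⁅(2 * δ) • S.ξ i - S.φ i S.Z, (2 * δ) • S.ξ j - S.φ j S.Z⁆ =
        (4 * δ ^ 2) • ((2 * δ) • S.ξ k - S.φ k S.Z)) := by
  refine ⟨⟨fun i X hX => S.lie_ξ_of_inH hψ i hX, fun i j k h => S.lie_ξ_ξ hδ h⟩,
    ⟨fun X Y hX hY => S.inH_lie_s18 hψ hZ hX hY,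
      fun x hx y => mem_H_iff.2 (S.lie_mem_H hψ hZ (mem_H_iff.1 hx) y)⟩,
    ⟨fun X hX => S.lie_Z hψ hX, fun i X hX => S.lie_φ_Z hψ i hX⟩, fun _ i j k h => ?_⟩
  rw [S.lie_smul_ξ_sub_φ_Z hψ, S.lie_ξ_ξ hδ h]
  congr 1
  ring
end
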